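/- Let Q be a probability measure and 𝒫' a convex, compact (in total variation or a suitable topology) set of probability measures with I(P||Q) < ∞ for all P ∈ 𝒫'. Then sup over all probability measures R of inf over P ∈ 𝒫' of [I(P||Q) − I(P||R)] equals inf over P ∈ 𝒫' of I(P||Q). -/

import Mathlib

open MeasureTheory Classical

/-- Kullback-Leibler divergence. -/
noncomputable def klDiv {Θ : Type*} [MeasurableSpace Θ] (P Q : Measure Θ) : EReal :=
  if P ≪ Q ∧ Integrable (fun θ => Real.log ((P.rnDeriv Q θ).toReal)) P then
    ((∫ θ, Real.log ((P.rnDeriv Q θ).toReal) ∂P : ℝ) : EReal)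
  else ⊤

noncomputable def kk (b m : ℝ) : ℝ := b * Real.log (b / m) + m - b

lemma kk_hell (a m : ℝ) (ha : 0 ≤ a) (hm : 0 ≤ m) (h : m = 0 → a = 0) :
    (√a - √m)^2 ≤ kk a m := by
  unfold kk
  rcases ha.eq_or_lt with rfl | ha'
  · simp [Real.sq_sqrt hm]
  have hm' : 0 < m := lt_of_le_of_ne hm (fun h' => ha'.ne' (h h'.symm))
  have hsa := Real.sqrt_pos.2 ha'
  have hsm := Real.sqrt_pos.2 hm'
  have h1 := Real.log_le_sub_one_of_pos (div_pos hsm hsa)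
  have h2 : Real.log (a / m) = -2 * Real.log (√m / √a) := by
    rw [Real.log_div ha'.ne' hm'.ne', Real.log_div hsm.ne' hsa.ne', Real.log_sqrt ha, Real.log_sqrt hm]
    ring
  have h3 : a * (√m/√a) = √a * √m := by
    field_simp
    rw [Real.sq_sqrt ha]
  rw [h2]
  nlinarith [Real.sq_sqrt ha, Real.sq_sqrt hm, mul_le_mul_of_nonneg_left h1 ha]

lemma kk_nonneg (a m : ℝ) (ha : 0 ≤ a) (hm : 0 ≤ m) (h : m = 0 → a = 0) : 0 ≤ kk a m :=
  (sq_nonneg _).trans (kk_hell a m ha hm h)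

lemma kk_aux (s a m : ℝ) (h : m = 0 → s * a = 0) :
    s * kk a m = s * (a * Real.log a) - s * a * Real.log m + s * m - s * a := by
  unfold kk
  by_cases hsa : s * a = 0
  · rcases mul_eq_zero.1 hsa with rfl | rfl <;> simp
  have hm : m ≠ 0 := fun h' => hsa (h h')
  have ha : a ≠ 0 := right_ne_zero_of_mul hsa
  rw [Real.log_div ha hm]; ring

lemma kk_identity (a b t : ℝ) (ha : 0 ≤ a) (hb : 0 ≤ b) (ht : 0 ≤ t) (ht1 : t ≤ 1) :
    t * (a * Real.log a) + (1 - t) * (b * Real.log b)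
      - (t * a + (1-t) * b) * Real.log (t * a + (1-t) * b)
    = t * kk a (t * a + (1-t) * b) + (1 - t) * kk b (t * a + (1-t) * b) := by
  have h1 : 0 ≤ t * a := mul_nonneg ht ha
  have h2 : 0 ≤ (1 - t) * b := mul_nonneg (by linarith) hb
  rw [kk_aux t a _ (fun h => by linarith), kk_aux (1-t) b _ (fun h => by linarith)]
  ring

lemma kk_left (a b t : ℝ) (ha : 0 ≤ a) (hb : 0 ≤ b) (ht : 0 < t) (ht1 : t ≤ 1) :
    t * kk a (t * a + (1-t) * b) ≤ t * (a * Real.log a) + (1 - t) * (b * Real.log b)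
      - (t * a + (1-t) * b) * Real.log (t * a + (1-t) * b) := by
  have h1 : 0 ≤ t * a := mul_nonneg ht.le ha
  have h2 : 0 ≤ (1 - t) * b := mul_nonneg (by linarith) hb
  rw [kk_identity a b t ha hb ht.le ht1]
  rcases ht1.eq_or_lt with rfl | h
  · simp
  have := kk_nonneg b (t * a + (1-t) * b) hb (by linarith) (fun h' => by
    have : (1 - t) * b = 0 := by linarith
    rcases mul_eq_zero.1 this with h3 | h3
    · linarith
    · exact h3)
  nlinarith

lemma kk_half (a b : ℝ) (ha : 0 ≤ a) (hb : 0 ≤ b) :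
    (√a - √b)^2 / 4 ≤ (1/2) * (a * Real.log a) + (1 - 1/2) * (b * Real.log b)
      - ((1/2) * a + (1-1/2) * b) * Real.log ((1/2) * a + (1-1/2) * b) := by
  rw [kk_identity a b (1/2) ha hb (by norm_num) (by norm_num)]
  have h1 := kk_hell a ((1/2) * a + (1-1/2) * b) ha (by linarith) (fun h => by linarith)
  have h2 := kk_hell b ((1/2) * a + (1-1/2) * b) hb (by linarith) (fun h => by linarith)
  set s := √((1/2) * a + (1-1/2) * b)
  nlinarith [sq_nonneg (√a + √b - 2 * s)]
open Filter Topology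
lemma kk_tendsto_pos (b m : ℝ) (hm : 0 < m) (f : ℕ → ℝ) (hf : Tendsto f atTop (𝓝 m)) :
    Tendsto (fun n => kk b (f n)) atTop (𝓝 (kk b m)) := by
  unfold kk
  by_cases hb : b = 0
  · subst hb; simpa using hf
  have : Tendsto (fun n => b / f n) atTop (𝓝 (b / m)) := tendsto_const_nhds.div hf hm.ne'
  exact ((((Real.continuousAt_log (div_ne_zero hb hm.ne')).tendsto.comp this).const_mul b).add hf).sub_const b

lemma kk_tendsto_zero (b : ℝ) (hb : 0 < b) (f : ℕ → ℝ) (hf : Tendsto f atTop (𝓝 0)) (hp : ∀ n, 0 < f n) :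
    Tendsto (fun n => kk b (f n)) atTop atTop := by
  unfold kk
  have h1 : Tendsto f atTop (𝓝[>] 0) := tendsto_nhdsWithin_iff.2 ⟨hf, Eventually.of_forall hp⟩
  have h2 : Tendsto (fun n => b / f n) atTop atTop := by
    simp_rw [div_eq_mul_inv]
    exact (tendsto_inv_nhdsGT_zero.comp h1).const_mul_atTop hb
  have h3 := (Real.tendsto_log_atTop.comp h2).const_mul_atTop hb
  have h4 := (h3.atTop_add hf)
  exact tendsto_atTop_add_const_right _ (-b) h4

lemma kk_measurable : Measurable (fun z : ℝ × ℝ => kk z.1 z.2) := by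
  unfold kk; fun_prop

lemma kk_core {α : Type*} [MeasurableSpace α] (Q : Measure α) [IsProbabilityMeasure Q]
    (D : Set (α → ℝ)) (hmeas : ∀ f ∈ D, Measurable f) (hnn : ∀ f ∈ D, ∀ x, 0 ≤ f x)
    (h_integrable : ∀ f ∈ D, Integrable f Q) (hone : ∀ f ∈ D, ∫ x, f x ∂Q = 1)
    (hphi : ∀ f ∈ D, Integrable (fun x => f x * Real.log (f x)) Q) (d : ℝ)
    (hconv : ∀ f ∈ D, ∀ g ∈ D, ∀ t : ℝ, 0 ≤ t → t ≤ 1 →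
      Integrable (fun x => (t * f x + (1-t) * g x) * Real.log (t * f x + (1-t) * g x)) Q ∧
      d ≤ ∫ x, (t * f x + (1-t) * g x) * Real.log (t * f x + (1-t) * g x) ∂Q)
    (happ : ∀ ε : ℝ, 0 < ε → ∃ f ∈ D, ∫ x, f x * Real.log (f x) ∂Q ≤ d + ε) :
    ∃ r : α → ℝ, Measurable r ∧ (∀ x, 0 ≤ r x) ∧ Integrable r Q ∧ ∫ x, r x ∂Q = 1 ∧
      ∀ p ∈ D, (∀ᵐ x ∂Q, r x = 0 → p x = 0) ∧
        ∫⁻ x, ENNReal.ofReal (kk (p x) (r x)) ∂Q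
          ≤ ENNReal.ofReal (∫ x, p x * Real.log (p x) ∂Q - d) := by
  have happ' : ∀ n : ℕ, ∃ f ∈ D, ∫ x, f x * Real.log (f x) ∂Q ≤ d + (1 / ((n:ℝ)+1))^2 :=
    fun n => happ _ (by positivity)
  choose f hfD hfle using happ'
  have hL : ∀ n, MemLp (fun x => √(f n x)) 2 Q := fun n => by
    rw [memLp_two_iff_integrable_sq (hmeas _ (hfD n)).sqrt.aestronglyMeasurable]
    refine (h_integrable _ (hfD n)).congr (ae_of_all _ fun x => ?_)
    simp [Real.sq_sqrt (hnn _ (hfD n) x)]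
  have hnorm : ∀ g : Lp ℝ 2 Q, ‖g‖^2 = ∫ x, (g x)^2 ∂Q := fun g => by
    rw [← real_inner_self_eq_norm_sq, L2.inner_def]
    refine integral_congr_ae (ae_of_all _ fun x => ?_)
    simp [sq]
  let F : ℕ → Lp ℝ 2 Q := fun n => (hL n).toLp _
  have hF : ∀ n, F n =ᵐ[Q] fun x => √(f n x) := fun n => (hL n).coeFn_toLp
  have hFnorm : ∀ n, ‖F n‖^2 = 1 := fun n => by
    rw [hnorm, ← hone _ (hfD n)]
    refine integral_congr_ae ?_
    filter_upwards [hF n] with x hx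
    rw [hx, Real.sq_sqrt (hnn _ (hfD n) x)]
  have hdist : ∀ n m, dist (F n) (F m) ^ 2 ≤ 2 * ((1 / ((n:ℝ)+1))^2 + (1 / ((m:ℝ)+1))^2) := by
    intro n m
    rw [dist_eq_norm, hnorm]
    have h1 : ∫ x, ((F n - F m : Lp ℝ 2 Q) x)^2 ∂Q = ∫ x, (√(f n x) - √(f m x))^2 ∂Q := by
      refine integral_congr_ae ?_
      filter_upwards [hF n, hF m, Lp.coeFn_sub (F n) (F m)] with x h1 h2 h3
      rw [h3, Pi.sub_apply, h1, h2]
    have hi : Integrable (fun x => (√(f n x) - √(f m x))^2) Q :=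
      ((hL n).sub (hL m)).integrable_sq
    obtain ⟨hc1, hc2⟩ := hconv _ (hfD n) _ (hfD m) (1/2) (by norm_num) (by norm_num)
    have hI1 := (hphi _ (hfD n)).const_mul (1/2)
    have hI2 := (hphi _ (hfD m)).const_mul (1-1/2)
    have h2 := integral_mono (hi.div_const 4) ((hI1.add hI2).sub hc1)
      (fun x => kk_half _ _ (hnn _ (hfD n) x) (hnn _ (hfD m) x))
    rw [integral_sub' (hI1.add hI2) hc1, integral_add' hI1 hI2, integral_div,
      integral_const_mul, integral_const_mul] at h2
    have := hfle n
    have := hfle m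
    rw [h1]
    linarith
  have hcau : CauchySeq F := by
    refine cauchySeq_of_le_tendsto_0 (fun n : ℕ => 2 * (1 / ((n:ℝ)+1))) ?_ ?_
    · intro n m N hn hm
      have hn' : 1 / ((n:ℝ)+1) ≤ 1 / ((N:ℝ)+1) := by gcongr
      have hm' : 1 / ((m:ℝ)+1) ≤ 1 / ((N:ℝ)+1) := by gcongr
      have h0 : 0 ≤ 1 / ((n:ℝ)+1) := by positivity
      have h0' : 0 ≤ 1 / ((m:ℝ)+1) := by positivity
      refine abs_le_of_sq_le_sq' ?_ (by positivity) |>.2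
      have := hdist n m
      nlinarith
    · simpa using (tendsto_one_div_add_atTop_nhds_zero_nat (𝕜 := ℝ)).const_mul 2
  obtain ⟨G, hG⟩ := cauchySeq_tendsto_of_complete hcau
  have hG1 : ‖G‖^2 = 1 := by
    have h1 := (hG.norm).pow 2
    simp_rw [hFnorm] at h1
    exact tendsto_nhds_unique h1 tendsto_const_nhds |>.symm ▸ rfl
  obtain ⟨ns, hns, hae⟩ := (tendstoInMeasure_of_tendsto_Lp hG).exists_seq_tendsto_ae
  have hGm : Measurable G := (Lp.stronglyMeasurable G).measurable
  refine ⟨fun x => (G x)^2, hGm.pow_const 2, fun x => sq_nonneg _, (Lp.memLp G).integrable_sq,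
    by rw [← hnorm, hG1], ?_⟩
  intro p hp
  have hfae : ∀ᵐ x ∂Q, Tendsto (fun i => f (ns i) x) atTop (𝓝 ((G x)^2)) := by
    filter_upwards [hae, ae_all_iff.2 hF] with x hx hx2
    refine (hx.pow 2).congr fun i => ?_
    rw [hx2, Real.sq_sqrt (hnn _ (hfD _) x)]
  let t : ℕ → ℝ := fun i => 1 / ((ns i : ℝ) + 1)
  have ht0 : ∀ i, 0 < t i := fun i => by positivity
  have ht1 : ∀ i, t i ≤ 1 := fun i => by
    simp only [t]
    rw [div_le_one (by positivity)]
    have : (0:ℝ) ≤ ns i := by positivity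
    linarith
  have htt : Tendsto t atTop (𝓝 0) :=
    (tendsto_one_div_add_atTop_nhds_zero_nat (𝕜 := ℝ)).comp hns.tendsto_atTop
  let m : ℕ → α → ℝ := fun i x => t i * p x + (1 - t i) * f (ns i) x
  have hmm : ∀ i, Measurable (m i) := fun i =>
    ((hmeas p hp).const_mul _).add ((hmeas _ (hfD _)).const_mul _)
  have hmae : ∀ᵐ x ∂Q, Tendsto (fun i => m i x) atTop (𝓝 ((G x)^2)) := by
    filter_upwards [hfae] with x hx
    simpa using (htt.mul_const (p x)).add ((htt.const_sub 1).mul hx)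
  have hbound : ∀ i, ∫⁻ x, ENNReal.ofReal (kk (p x) (m i x)) ∂Q
      ≤ ENNReal.ofReal (∫ x, p x * Real.log (p x) ∂Q - d + t i) := by
    intro i
    obtain ⟨hc1, hc2⟩ := hconv _ hp _ (hfD (ns i)) (t i) (ht0 i).le (ht1 i)
    have hI1 := (hphi _ hp).const_mul (t i)
    have hI2 := (hphi _ (hfD (ns i))).const_mul (1 - t i)
    have hI := ((hI1.add hI2).sub hc1).div_const (t i)
    have hle : ∀ x, kk (p x) (m i x) ≤ _ := fun x =>
      (le_div_iff₀' (ht0 i)).2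
        (kk_left (p x) (f (ns i) x) (t i) (hnn _ hp x) (hnn _ (hfD _) x) (ht0 i) (ht1 i))
    have hmn : ∀ x, 0 ≤ (1 - t i) * f (ns i) x := fun x =>
        mul_nonneg (by linarith [ht1 i]) (hnn _ (hfD _) x)
    have hk0 : ∀ x, 0 ≤ kk (p x) (m i x) := fun x => by
      have h1 := mul_nonneg (ht0 i).le (hnn _ hp x)
      refine kk_nonneg _ _ (hnn _ hp x) (add_nonneg h1 (hmn x)) fun h => ?_
      have h2 : t i * p x = 0 := by have := hmn x; simp only [m] at h; linarith
      exact (mul_eq_zero.1 h2).resolve_left (ht0 i).ne'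
    refine (lintegral_mono fun x => ENNReal.ofReal_le_ofReal (hle x)).trans ?_
    refine (ofReal_integral_eq_lintegral_ofReal hI
      (ae_of_all _ fun x => (hk0 x).trans (hle x))).symm.le.trans ?_
    refine ENNReal.ofReal_le_ofReal ?_
    rw [integral_div]
    refine (div_le_iff₀' (ht0 i)).2 ?_
    rw [integral_sub' (hI1.add hI2) hc1, integral_add' hI1 hI2,
      integral_const_mul, integral_const_mul]
    have h3 : ∫ x, f (ns i) x * Real.log (f (ns i) x) ∂Q ≤ d + (t i)^2 := hfle (ns i)
    have h4 := mul_le_mul_of_nonneg_left h3 (by linarith [ht1 i] : 0 ≤ 1 - t i)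
    nlinarith [pow_pos (ht0 i) 3]
  have hlim : Tendsto (fun i => ENNReal.ofReal (∫ x, p x * Real.log (p x) ∂Q - d + t i)) atTop
      (𝓝 (ENNReal.ofReal (∫ x, p x * Real.log (p x) ∂Q - d))) := by
    refine ENNReal.tendsto_ofReal ?_
    simpa using htt.const_add (∫ x, p x * Real.log (p x) ∂Q - d)
  have hmk : ∀ i, Measurable (fun x => ENNReal.ofReal (kk (p x) (m i x))) := fun i =>
    (kk_measurable.comp ((hmeas p hp).prodMk (hmm i))).ennreal_ofReal
  have hfatou : ∫⁻ x, liminf (fun i => ENNReal.ofReal (kk (p x) (m i x))) atTop ∂Q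
      ≤ ENNReal.ofReal (∫ x, p x * Real.log (p x) ∂Q - d) := by
    refine (lintegral_liminf_le hmk).trans ?_
    rw [← hlim.liminf_eq]
    exact liminf_le_liminf (Eventually.of_forall hbound)
  have hfin := ae_lt_top (.liminf hmk) (hfatou.trans_lt ENNReal.ofReal_lt_top).ne
  have hac : ∀ᵐ x ∂Q, (G x)^2 = 0 → p x = 0 := by
    filter_upwards [hfin, hmae] with x hx hx2 h0
    by_contra hne
    have hpos : 0 < p x := lt_of_le_of_ne (hnn _ hp x) (Ne.symm hne)
    rw [h0] at hx2
    have := ENNReal.tendsto_ofReal_atTop.comp (kk_tendsto_zero (p x) hpos _ hx2 (fun i => by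
      have h1 := mul_pos (ht0 i) hpos
      have h2 : 0 ≤ (1 - t i) * f (ns i) x :=
        mul_nonneg (by linarith [ht1 i]) (hnn _ (hfD _) x)
      exact add_pos_of_pos_of_nonneg h1 h2))
    have h5 := this.liminf_eq
    simp only [Function.comp_def] at h5
    rw [h5] at hx
    exact lt_irrefl _ hx
  refine ⟨hac, le_trans (lintegral_mono_ae ?_) hfatou⟩
  filter_upwards [hac, hmae] with x hx hx2
  by_cases h0 : (G x)^2 = 0
  · simp [h0, hx h0, kk]
  · have := ENNReal.tendsto_ofReal
      (kk_tendsto_pos (p x) _ (lt_of_le_of_ne (sq_nonneg _) (Ne.symm h0)) _ hx2)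
    exact this.liminf_eq.symm.le

lemma kk_bridge {α : Type*} [MeasurableSpace α] (P Q : Measure α) [IsProbabilityMeasure P]
    [IsProbabilityMeasure Q] (hPQ : P ≪ Q) (r : α → ℝ) (hr : Measurable r) (hr0 : ∀ x, 0 ≤ r x)
    [IsProbabilityMeasure (Q.withDensity fun x => ENNReal.ofReal (r x))]
    (hac : ∀ᵐ x ∂Q, r x = 0 → (P.rnDeriv Q x).toReal = 0) :
    InformationTheory.klDiv P (Q.withDensity fun x => ENNReal.ofReal (r x)) =
      ∫⁻ x, ENNReal.ofReal (kk (P.rnDeriv Q x).toReal (r x)) ∂Q := by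
  set R := Q.withDensity fun x => ENNReal.ofReal (r x) with hR
  have hpm : Measurable fun x => (P.rnDeriv Q x).toReal := (Measure.measurable_rnDeriv P Q).ennreal_toReal
  have hqm : Measurable fun x => ENNReal.ofReal ((P.rnDeriv Q x).toReal / r x) :=
    (hpm.div hr).ennreal_ofReal
  have hP : P = R.withDensity fun x => ENNReal.ofReal ((P.rnDeriv Q x).toReal / r x) := by
    rw [hR, ← withDensity_mul _ hr.ennreal_ofReal hqm]
    conv_lhs => rw [← Measure.withDensity_rnDeriv_eq P Q hPQ]
    refine withDensity_congr_ae ?_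
    filter_upwards [hac, Measure.rnDeriv_lt_top P Q] with x hx hx2
    rw [Pi.mul_apply, ← ENNReal.ofReal_mul (hr0 x)]
    by_cases h0 : r x = 0
    · have := hx h0
      rw [ENNReal.toReal_eq_zero_iff] at this
      simp [h0, this.resolve_right hx2.ne]
    · rw [mul_div_cancel₀ _ h0, ENNReal.ofReal_toReal hx2.ne]
  have hPR : P ≪ R := by
    rw [hP]; exact withDensity_absolutelyContinuous _ _
  have hrn : P.rnDeriv R =ᵐ[R] fun x => ENNReal.ofReal ((P.rnDeriv Q x).toReal / r x) := by
    have := Measure.rnDeriv_withDensity R hqm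
    rwa [← hP] at this
  rw [InformationTheory.klDiv_eq_lintegral_klFun_of_ac hPR]
  have h1 : ∫⁻ x, ENNReal.ofReal (InformationTheory.klFun (P.rnDeriv R x).toReal) ∂(R)
     = ∫⁻ x, ENNReal.ofReal (InformationTheory.klFun ((P.rnDeriv Q x).toReal / r x)) ∂(R) := by
    refine lintegral_congr_ae ?_
    filter_upwards [hrn] with x hx
    rw [hx, ENNReal.toReal_ofReal (div_nonneg ENNReal.toReal_nonneg (hr0 x))]
  have hkm : Measurable fun x =>
      ENNReal.ofReal (InformationTheory.klFun ((P.rnDeriv Q x).toReal / r x)) :=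
    (InformationTheory.measurable_klFun.comp (hpm.div hr)).ennreal_ofReal
  rw [h1, hR, lintegral_withDensity_eq_lintegral_mul _ hr.ennreal_ofReal hkm]
  refine lintegral_congr_ae ?_
  filter_upwards [hac] with x hx
  rw [Pi.mul_apply, ← ENNReal.ofReal_mul (hr0 x)]
  congr 1
  by_cases h0 : r x = 0
  · simp [h0, hx h0, kk]
  · rw [InformationTheory.klFun_apply, kk]
    field_simp

lemma klDiv_nonneg' {α : Type*} [MeasurableSpace α] (P Q : Measure α) [IsProbabilityMeasure P]
    [IsProbabilityMeasure Q] : 0 ≤ klDiv P Q := by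
  unfold klDiv
  split_ifs with h
  · have := InformationTheory.integral_llr_add_sub_measure_univ_nonneg h.1 h.2
    simp only [probReal_univ, add_sub_cancel_right] at this
    exact_mod_cast this
  · exact le_top

lemma klDiv_real {α : Type*} [MeasurableSpace α] (P Q : Measure α) [IsProbabilityMeasure P]
    [IsProbabilityMeasure Q] (h : klDiv P Q < ⊤) : P ≪ Q ∧
    Integrable (fun x => (P.rnDeriv Q x).toReal * Real.log (P.rnDeriv Q x).toReal) Q ∧
    klDiv P Q = ((∫ x, (P.rnDeriv Q x).toReal * Real.log (P.rnDeriv Q x).toReal ∂Q : ℝ) : EReal) := by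
  unfold klDiv at h ⊢
  split_ifs at h ⊢ with h'
  · refine ⟨h'.1, (integrable_rnDeriv_smul_iff h'.1).2 h'.2, ?_⟩
    rw [← integral_rnDeriv_smul h'.1]; rfl
  · exact absurd h (lt_irrefl _)

/-- Minimax equilibrium for the inferential gain (Lemma 1, Topsøe/Csiszár):
`sup_R inf_{P ∈ 𝒫'} [I(P‖Q) − I(P‖R)] = inf_{P ∈ 𝒫'} I(P‖Q)`. -/
theorem inferentialGain_minimax {Θ : Type*} [MeasurableSpace Θ] [TopologicalSpace Θ]
    [OpensMeasurableSpace Θ]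
    (Q : ProbabilityMeasure Θ) (S : Set (ProbabilityMeasure Θ))
    (hne : S.Nonempty)
    (hconv : ∀ P ∈ S, ∀ P' ∈ S, ∀ t : ℝ, 0 ≤ t → t ≤ 1 →
      ∃ R ∈ S, (R : Measure Θ) =
        ENNReal.ofReal t • (P : Measure Θ) + ENNReal.ofReal (1 - t) • (P' : Measure Θ))
    (hcompact : IsCompact S)
    (hfin : ∀ P ∈ S, klDiv (P : Measure Θ) (Q : Measure Θ) < ⊤) :
    (⨆ R : ProbabilityMeasure Θ, ⨅ P ∈ S,
        (klDiv (P : Measure Θ) (Q : Measure Θ) - klDiv (P : Measure Θ) (R : Measure Θ))) =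
      ⨅ P ∈ S, klDiv (P : Measure Θ) (Q : Measure Θ) := by
  apply le_antisymm
  · refine iSup_le fun R => iInf₂_mono fun P hP => ?_
    refine EReal.sub_le_of_le_add ?_
    exact le_add_of_nonneg_right (klDiv_nonneg' _ _)
  set e := ⨅ P ∈ S, klDiv (P : Measure Θ) (Q : Measure Θ) with he
  have hele : ∀ P ∈ S, e ≤ klDiv (P : Measure Θ) (Q : Measure Θ) := fun P hP => iInf₂_le P hP
  have he0 : 0 ≤ e := le_iInf₂ fun P _ => klDiv_nonneg' _ _
  have het : e < ⊤ := by
    obtain ⟨P, hP⟩ := hne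
    exact (hele P hP).trans_lt (hfin P hP)
  obtain ⟨d, hd⟩ : ∃ d : ℝ, e = d :=
    ⟨e.toReal, (EReal.coe_toReal het.ne (ne_bot_of_le_ne_bot (by simp) he0)).symm⟩
  obtain ⟨r, hrm, hr0, hri, hr1, hr⟩ := kk_core (Q : Measure Θ)
    ((fun P : ProbabilityMeasure Θ => fun x => ((P : Measure Θ).rnDeriv Q x).toReal) '' S)
    (by rintro _ ⟨P, hP, rfl⟩; exact (Measure.measurable_rnDeriv _ _).ennreal_toReal)
    (by rintro _ ⟨P, hP, rfl⟩ x; exact ENNReal.toReal_nonneg)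
    (by rintro _ ⟨P, hP, rfl⟩; exact Measure.integrable_toReal_rnDeriv)
    (by
      rintro _ ⟨P, hP, rfl⟩
      simpa using Measure.integral_toReal_rnDeriv (klDiv_real _ _ (hfin P hP)).1)
    (by rintro _ ⟨P, hP, rfl⟩; exact (klDiv_real _ _ (hfin P hP)).2.1)
    d
    (by
      rintro _ ⟨P, hP, rfl⟩ _ ⟨P', hP', rfl⟩ t ht0 ht1
      obtain ⟨R, hRS, hR⟩ := hconv P hP P' hP' t ht0 ht1
      obtain ⟨-, h2, h3⟩ := klDiv_real _ _ (hfin R hRS)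
      have h4 := hele R hRS
      rw [h3, hd, EReal.coe_le_coe_iff] at h4
      have hae : (fun x => ((R : Measure Θ).rnDeriv Q x).toReal) =ᵐ[(Q : Measure Θ)] fun x =>
          t * ((P : Measure Θ).rnDeriv Q x).toReal
            + (1 - t) * ((P' : Measure Θ).rnDeriv Q x).toReal := by
        have : IsFiniteMeasure (ENNReal.ofReal t • (P : Measure Θ)) :=
          Measure.smul_finite _ ENNReal.ofReal_ne_top
        have : IsFiniteMeasure (ENNReal.ofReal (1 - t) • (P' : Measure Θ)) :=
          Measure.smul_finite _ ENNReal.ofReal_ne_top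
        rw [hR]
        filter_upwards [Measure.rnDeriv_add (ENNReal.ofReal t • (P : Measure Θ))
          (ENNReal.ofReal (1 - t) • (P' : Measure Θ)) (Q : Measure Θ),
          Measure.rnDeriv_smul_left_of_ne_top (P : Measure Θ) (Q : Measure Θ)
            (ENNReal.ofReal_ne_top (r := t)),
          Measure.rnDeriv_smul_left_of_ne_top (P' : Measure Θ) (Q : Measure Θ)
            (ENNReal.ofReal_ne_top (r := 1 - t)),
          Measure.rnDeriv_lt_top (P : Measure Θ) (Q : Measure Θ),
          Measure.rnDeriv_lt_top (P' : Measure Θ) (Q : Measure Θ)] with x h1 h2 h3 h4 h5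
        rw [h1, Pi.add_apply, h2, h3, Pi.smul_apply, Pi.smul_apply, smul_eq_mul, smul_eq_mul,
          ENNReal.toReal_add (ENNReal.mul_ne_top ENNReal.ofReal_ne_top h4.ne)
            (ENNReal.mul_ne_top ENNReal.ofReal_ne_top h5.ne), ENNReal.toReal_mul,
          ENNReal.toReal_mul, ENNReal.toReal_ofReal ht0, ENNReal.toReal_ofReal (by linarith)]
      have hae2 := hae.fun_comp (fun y => y * Real.log y)
      exact ⟨h2.congr hae2, h4.trans_eq (integral_congr_ae hae2)⟩)
    (by
      intro ε hε
      have h1 : e < ((d + ε : ℝ) : EReal) := by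
        rw [hd, EReal.coe_lt_coe_iff]; linarith
      rw [he] at h1
      simp only [iInf_lt_iff] at h1
      obtain ⟨P, hP, h2⟩ := h1
      rw [(klDiv_real _ _ (hfin P hP)).2.2, EReal.coe_lt_coe_iff] at h2
      exact ⟨_, ⟨P, hP, rfl⟩, h2.le⟩)
  have hprob : IsProbabilityMeasure
      ((Q : Measure Θ).withDensity fun x => ENNReal.ofReal (r x)) := by
    constructor
    rw [withDensity_apply _ MeasurableSet.univ, Measure.restrict_univ,
      ← ofReal_integral_eq_lintegral_ofReal hri (ae_of_all _ hr0), hr1, ENNReal.ofReal_one]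
  refine le_iSup_of_le
    (⟨(Q : Measure Θ).withDensity fun x => ENNReal.ofReal (r x), hprob⟩ : ProbabilityMeasure Θ) ?_
  refine le_iInf₂ fun P hP => ?_
  obtain ⟨hac, hle⟩ := hr _ ⟨P, hP, rfl⟩
  obtain ⟨hPQ, -, hkl⟩ := klDiv_real _ _ (hfin P hP)
  rw [← kk_bridge (P : Measure Θ) (Q : Measure Θ) hPQ r hrm hr0 hac] at hle
  have hdle := hele P hP
  rw [hkl, hd, EReal.coe_le_coe_iff] at hdle
  obtain ⟨h1, h2⟩ := InformationTheory.klDiv_ne_top_iff.1 (hle.trans_lt ENNReal.ofReal_lt_top).ne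
  have h3 := ENNReal.toReal_mono ENNReal.ofReal_ne_top hle
  rw [ENNReal.toReal_ofReal (by linarith), InformationTheory.toReal_klDiv_of_measure_eq h1
    (by simp)] at h3
  rw [hkl, hd]
  have h4 : klDiv (P : Measure Θ) ((Q : Measure Θ).withDensity fun x => ENNReal.ofReal (r x)) =
    ((∫ x, llr (P : Measure Θ) ((Q : Measure Θ).withDensity fun x => ENNReal.ofReal (r x)) x
      ∂(P : Measure Θ) : ℝ) : EReal) := if_pos ⟨h1, h2⟩
  rw [ProbabilityMeasure.coe_mk, h4, ← EReal.coe_sub, EReal.coe_le_coe_iff]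
  linarith
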